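/- Let a, b > 0, let n be a positive integer, and let Δ be the Hirzebruch trapezoid with vertices (0,0), (0,a), (b,a), (b+na,0). Then the toric packing density satisfies: ρ_T(Δ) = 2a/(na+2b) if n > 1; ρ_T(Δ) = 2a/(a+2b) if n = 1 and a ≤ b; ρ_T(Δ) = (a² + b² + (a−b)²)/((a+2b)a) if n = 1 and b < a < 2b; and ρ_T(Δ) = (a² + 2b²)/((a+2b)a) if n = 1 and a ≥ 2b. -/

import Mathlib

open Matrix MeasureTheory Set

/-- Points of the plane. -/
abbrev Pt := Fin 2 → ℝ

/-- The action of `SL₂(ℤ)` on `ℝ²` by matrix-vector multiplication. -/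
noncomputable def sl2Apply (M : Matrix.SpecialLinearGroup (Fin 2) ℤ) (x : Pt) : Pt :=
  ((M : Matrix (Fin 2) (Fin 2) ℤ).map (Int.cast : ℤ → ℝ)).mulVec x

/-- The model triangle `B(λ) = {(x,y) : x ≥ 0, y ≥ 0, x + y < λ}`. -/
def modelTriangle (lam : ℝ) : Set Pt :=
  {x | 0 ≤ x 0 ∧ 0 ≤ x 1 ∧ x 0 + x 1 < lam}

/-- The area (Lebesgue measure) of a subset of the plane. -/
noncomputable def area (S : Set Pt) : ℝ := (volume S).toReal

/-- `B ⊆ Δ` is an admissibly packed triangle at the point `p` of `SL₂(ℤ)`-size `lam`: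
`B = M (B(lam)) + p` for some `M ∈ SL₂(ℤ)` and `B` coincides with `Δ`
in a neighborhood of `p`. -/
def IsPackedTriangle (Δ : Set Pt) (p : Pt) (lam : ℝ) (B : Set Pt) : Prop :=
  0 < lam ∧ B ⊆ Δ ∧
  (∃ M : Matrix.SpecialLinearGroup (Fin 2) ℤ,
      B = (fun x => sl2Apply M x + p) '' modelTriangle lam) ∧
  ∃ U : Set Pt, IsOpen U ∧ p ∈ U ∧ B ∩ U = Δ ∩ U

/-- `P` is a (toric) packing of the convex polygon with vertices `V`, where the triangle
packed at the vertex `V i` has `SL₂(ℤ)`-size `sz i` (with `sz i = 0` if no triangle is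
packed there): `P` is a union of pairwise disjoint admissibly packed triangles. -/
def IsPacking {k : ℕ} (V : Fin k → Pt) (sz : Fin k → ℝ) (P : Set Pt) : Prop :=
  ∃ tri : Fin k → Set Pt,
    P = (⋃ i, tri i) ∧
    (∀ i, (sz i = 0 ∧ tri i = ∅) ∨
       IsPackedTriangle (convexHull ℝ (Set.range V)) (V i) (sz i) (tri i)) ∧
    Pairwise (Function.onFun Disjoint tri)

/-- The set of densities `area P / area Δ` of packings `P` of the polygon with
vertices `V`; the toric packing density `ρ_T` is its supremum. -/
def densitySet {k : ℕ} (V : Fin k → Pt) : Set ℝ :=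
  {r : ℝ | ∃ sz P, IsPacking V sz P ∧ r = area P / area (convexHull ℝ (Set.range V))}

/-- The determinant of a pair of integer vectors in the plane. -/
def detZ (u v : Fin 2 → ℤ) : ℤ := u 0 * v 1 - u 1 * v 0

/-- `V, dir, len` describe a Delzant polygon with `k` vertices `V i`, listed in clockwise
order: the edge from `V i` to `V (i+1)` is directed along the primitive integer vector
`dir i` and has `SL₂(ℤ)`-length `len i`, and each vertex satisfies the Delzant
condition `det (u₁, u₂) = ± 1`. -/
structure IsDelzantPolygon {k : ℕ} [NeZero k] (V : Fin k → Pt)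
    (dir : Fin k → Fin 2 → ℤ) (len : Fin k → ℝ) : Prop where
  three_le : 3 ≤ k
  len_pos : ∀ i, 0 < len i
  primitive : ∀ i, Int.gcd (dir i 0) (dir i 1) = 1
  edge_eq : ∀ i j, V (i + 1) j - V i j = len i * (dir i j : ℝ)
  clockwise : ∀ i, detZ (dir i) (dir (i + 1)) < 0
  delzant : ∀ i, detZ (dir i) (dir (i + 1)) = 1 ∨ detZ (dir i) (dir (i + 1)) = -1
  edges_boundary : ∀ i, segment ℝ (V i) (V (i + 1)) ⊆ frontier (convexHull ℝ (Set.range V))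

theorem sl2Apply_zero_coord (M : Matrix.SpecialLinearGroup (Fin 2) ℤ) (x : Pt) :
    sl2Apply M x 0 = (M 0 0 : ℝ) * x 0 + (M 0 1 : ℝ) * x 1 := by
  simp [sl2Apply, Matrix.mulVec, dotProduct, Fin.sum_univ_two]

theorem sl2Apply_one_coord (M : Matrix.SpecialLinearGroup (Fin 2) ℤ) (x : Pt) :
    sl2Apply M x 1 = (M 1 0 : ℝ) * x 0 + (M 1 1 : ℝ) * x 1 := by
  simp [sl2Apply, Matrix.mulVec, dotProduct, Fin.sum_univ_two]

theorem sl2Apply_mul (M N : Matrix.SpecialLinearGroup (Fin 2) ℤ) (x : Pt) :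
    sl2Apply (M * N) x = sl2Apply M (sl2Apply N x) := by
  ext i
  fin_cases i <;>
    simp [sl2Apply_zero_coord, sl2Apply_one_coord, Matrix.mul_apply, Fin.sum_univ_two] <;> ring

theorem sl2Apply_one (x : Pt) : sl2Apply 1 x = x := by
  ext i
  fin_cases i <;> simp [sl2Apply_zero_coord, sl2Apply_one_coord]

theorem sl2Apply_inv_apply (M : Matrix.SpecialLinearGroup (Fin 2) ℤ) (x : Pt) :
    sl2Apply M⁻¹ (sl2Apply M x) = x := by
  rw [← sl2Apply_mul, inv_mul_cancel, sl2Apply_one]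

theorem sl2Apply_apply_inv (M : Matrix.SpecialLinearGroup (Fin 2) ℤ) (x : Pt) :
    sl2Apply M (sl2Apply M⁻¹ x) = x := by
  rw [← sl2Apply_mul, mul_inv_cancel, sl2Apply_one]

theorem sl2Apply_smul (M : Matrix.SpecialLinearGroup (Fin 2) ℤ) (c : ℝ) (x : Pt) :
    sl2Apply M (c • x) = c • sl2Apply M x :=
  Matrix.mulVec_smul _ c x

theorem continuous_sl2Apply (M : Matrix.SpecialLinearGroup (Fin 2) ℤ) :
    Continuous (sl2Apply M) := by
  unfold sl2Apply
  fun_prop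

/-- The triangle of size `s` with apex `p` spanned by the columns of `D`. -/
def cornerTriangle (D : Matrix.SpecialLinearGroup (Fin 2) ℤ) (p : Pt) (s : ℝ) : Set Pt :=
  (fun x => sl2Apply D x + p) '' modelTriangle s

theorem mem_cornerTriangle {D : Matrix.SpecialLinearGroup (Fin 2) ℤ} {p z : Pt} {s : ℝ} :
    z ∈ cornerTriangle D p s ↔ sl2Apply D⁻¹ (z - p) ∈ modelTriangle s := by
  constructor
  · rintro ⟨x, hx, rfl⟩
    simpa [sl2Apply_inv_apply] using hx
  · intro h
    exact ⟨_, h, by simp [sl2Apply_apply_inv]⟩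

theorem mem_cornerTriangle_iff {D : Matrix.SpecialLinearGroup (Fin 2) ℤ} {p z : Pt} {s : ℝ} :
    z ∈ cornerTriangle D p s ↔
      0 ≤ (D 1 1 : ℝ) * (z 0 - p 0) - D 0 1 * (z 1 - p 1) ∧
      0 ≤ (D 0 0 : ℝ) * (z 1 - p 1) - D 1 0 * (z 0 - p 0) ∧
      (D 1 1 : ℝ) * (z 0 - p 0) - D 0 1 * (z 1 - p 1) +
        ((D 0 0 : ℝ) * (z 1 - p 1) - D 1 0 * (z 0 - p 0)) < s := by
  have e0 : sl2Apply D⁻¹ (z - p) 0 = (D 1 1 : ℝ) * (z 0 - p 0) - D 0 1 * (z 1 - p 1) := by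
    rw [sl2Apply_zero_coord]
    simp [Matrix.SpecialLinearGroup.SL2_inv_expl]
    ring
  have e1 : sl2Apply D⁻¹ (z - p) 1 = (D 0 0 : ℝ) * (z 1 - p 1) - D 1 0 * (z 0 - p 0) := by
    rw [sl2Apply_one_coord]
    simp [Matrix.SpecialLinearGroup.SL2_inv_expl]
    ring
  rw [mem_cornerTriangle, modelTriangle, mem_ofPred_eq, e0, e1]

/-- An integral unimodular matrix which, together with its inverse, preserves the closed
positive quadrant in an orientation preserving way is the identity. -/
theorem eq_one_of_nonneg_of_inv_nonneg (N : Matrix.SpecialLinearGroup (Fin 2) ℤ)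
    (h : ∀ i j, 0 ≤ N i j) (h' : ∀ i j, 0 ≤ N⁻¹ i j) : N = 1 := by
  have hdet := N.det_coe
  rw [Matrix.det_fin_two] at hdet
  have e01 : N⁻¹ 0 1 = -N 0 1 := by simp [Matrix.SpecialLinearGroup.SL2_inv_expl]
  have e10 : N⁻¹ 1 0 = -N 1 0 := by simp [Matrix.SpecialLinearGroup.SL2_inv_expl]
  have h01 : N 0 1 = 0 := by linarith [h 0 1, h' 0 1]
  have h10 : N 1 0 = 0 := by linarith [h 1 0, h' 1 0]
  have hmul : N 0 0 * N 1 1 = 1 := by simpa [h01] using hdet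
  have h00 : N 0 0 = 1 := Int.eq_one_of_mul_eq_one_right (h 0 0) hmul
  have h11 : N 1 1 = 1 := by simpa [h00] using hmul
  ext i j
  fin_cases i <;> fin_cases j <;> simp [h00, h01, h10, h11]

/-- The frame `D` spans the polygon `Δ` at the vertex `p`: `Δ` is contained in the cone at `p`
spanned by the columns of `D` and contains a small triangle in that cone. -/
structure IsCornerFrame (Δ : Set Pt) (p : Pt) (D : Matrix.SpecialLinearGroup (Fin 2) ℤ) :
    Prop where
  subset_cone : ∀ z ∈ Δ, ∃ s, z ∈ cornerTriangle D p s
  exists_subset : ∃ L : ℝ, 0 < L ∧ cornerTriangle D p L ⊆ Δ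

theorem exists_small_column {U : Set Pt} {p : Pt} (hU : IsOpen U) (hp : p ∈ U) {L : ℝ}
    (hL : 0 < L) (M : Matrix.SpecialLinearGroup (Fin 2) ℤ) (j : Fin 2) :
    ∃ t : ℝ, 0 < t ∧ sl2Apply M (t • Pi.single j 1) + p ∈ U ∩ cornerTriangle M p L := by
  have hc : Continuous fun t : ℝ => sl2Apply M (t • (Pi.single j 1 : Pt)) + p :=
    ((continuous_sl2Apply M).comp (by fun_prop)).add continuous_const
  have hmem : ∀ᶠ t in nhdsWithin (0 : ℝ) (Ioi 0),
      sl2Apply M (t • (Pi.single j 1 : Pt)) + p ∈ U := by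
    refine nhdsWithin_le_nhds (hc.continuousAt.eventually (hU.mem_nhds ?_))
    have h0 : sl2Apply M 0 = 0 := Matrix.mulVec_zero _
    simpa [h0] using hp
  have hlt : ∀ᶠ t in nhdsWithin (0 : ℝ) (Ioi 0), t ∈ Ioo 0 L := Ioo_mem_nhdsGT hL
  obtain ⟨t, htU, ht⟩ := (hmem.and hlt).exists
  refine ⟨t, ht.1, htU, _, ?_, rfl⟩
  fin_cases j <;> simp [modelTriangle, ht.1.le, ht.2]

theorem entry_nonneg_of_sl2Apply_single {N : Matrix.SpecialLinearGroup (Fin 2) ℤ} {t : ℝ}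
    (ht : 0 < t) {i j : Fin 2} (h : 0 ≤ sl2Apply N (t • Pi.single j 1) i) : 0 ≤ N i j := by
  rw [sl2Apply_smul, Pi.smul_apply, smul_eq_mul] at h
  have h2 := nonneg_of_mul_nonneg_right h ht
  have h3 : sl2Apply N (Pi.single j 1) i = (N i j : ℝ) := by simp [sl2Apply]
  rw [h3] at h2
  exact_mod_cast h2

theorem IsPackedTriangle.eq_cornerTriangle {Δ B : Set Pt} {p : Pt} {s : ℝ}
    {D : Matrix.SpecialLinearGroup (Fin 2) ℤ} (hD : IsCornerFrame Δ p D)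
    (hB : IsPackedTriangle Δ p s B) : B = cornerTriangle D p s := by
  obtain ⟨hs, hsub, ⟨M, hM⟩, U, hU, hpU, hBU⟩ := hB
  change B = cornerTriangle M p s at hM
  obtain ⟨L, hL, hLΔ⟩ := hD.exists_subset
  suffices h : D⁻¹ * M = 1 by rw [hM, inv_mul_eq_one.mp h]
  refine eq_one_of_nonneg_of_inv_nonneg _ (fun i j => ?_) (fun i j => ?_)
  · obtain ⟨t, ht, -, hz⟩ := exists_small_column hU hpU hs M j
    refine entry_nonneg_of_sl2Apply_single ht ?_
    obtain ⟨s', hs'⟩ := hD.subset_cone _ (hsub (hM ▸ hz))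
    rw [mem_cornerTriangle, add_sub_cancel_right, ← sl2Apply_mul] at hs'
    fin_cases i
    exacts [hs'.1, hs'.2.1]
  · obtain ⟨t, ht, hzU, hz⟩ := exists_small_column hU hpU hL D j
    refine entry_nonneg_of_sl2Apply_single ht ?_
    have hzB : sl2Apply D (t • Pi.single j 1) + p ∈ B ∩ U := hBU ▸ ⟨hLΔ hz, hzU⟩
    have hzM := mem_cornerTriangle.mp (hM ▸ hzB.1)
    rw [add_sub_cancel_right, ← sl2Apply_mul] at hzM
    rw [_root_.mul_inv_rev, inv_inv]
    fin_cases i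
    exacts [hzM.1, hzM.2.1]

theorem IsCornerFrame.isPackedTriangle {Δ : Set Pt} {p : Pt} {s : ℝ}
    {D : Matrix.SpecialLinearGroup (Fin 2) ℤ} (hD : IsCornerFrame Δ p D) (hs : 0 < s)
    (hsub : cornerTriangle D p s ⊆ Δ) : IsPackedTriangle Δ p s (cornerTriangle D p s) := by
  refine ⟨hs, hsub, ⟨D, rfl⟩,
    {z | sl2Apply D⁻¹ (z - p) 0 + sl2Apply D⁻¹ (z - p) 1 < s}, ?_, ?_, ?_⟩
  · have hc : Continuous fun z => sl2Apply D⁻¹ (z - p) :=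
      (continuous_sl2Apply D⁻¹).comp (by fun_prop)
    exact isOpen_lt (by fun_prop) continuous_const
  · simpa [sl2Apply_zero_coord, sl2Apply_one_coord] using hs
  · ext z
    refine ⟨fun h => ⟨hsub h.1, h.2⟩, fun h => ⟨mem_cornerTriangle.mpr ?_, h.2⟩⟩
    obtain ⟨s', hs'⟩ := hD.subset_cone z h.1
    exact ⟨(mem_cornerTriangle.mp hs').1, (mem_cornerTriangle.mp hs').2.1, h.2⟩

/-- Cavalieri's principle for a planar set whose horizontal slices have affine length. -/
theorem volume_eq_of_slices {S : Set Pt} (hS : MeasurableSet S) {h m k : ℝ} (hh : 0 ≤ h)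
    (hm : 0 ≤ m) (hk : 0 ≤ k)
    (hin : ∀ y ∈ Icc 0 h, volume {x : ℝ | ![x, y] ∈ S} = ENNReal.ofReal (m + k * (h - y)))
    (hout : ∀ y ∉ Icc 0 h, {x : ℝ | ![x, y] ∈ S} = ∅) :
    volume S = ENNReal.ofReal (m * h + k * h ^ 2 / 2) := by
  have hmp := (volume_preserving_finTwoArrow ℝ).symm
  rw [← hmp.measure_preimage hS.nullMeasurableSet, Measure.volume_eq_prod,
    Measure.prod_apply_symm (MeasurableEquiv.measurable _ hS)]
  have hslice : ∀ y : ℝ, volume ((fun x => (x, y)) ⁻¹'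
      ((MeasurableEquiv.finTwoArrow (α := ℝ)).symm ⁻¹' S)) =
      (Icc 0 h).indicator (fun y => ENNReal.ofReal (m + k * (h - y))) y := by
    intro y
    have e : ((fun x => (x, y)) ⁻¹' ((MeasurableEquiv.finTwoArrow (α := ℝ)).symm ⁻¹' S)) =
        {x : ℝ | ![x, y] ∈ S} := rfl
    rw [e]
    by_cases hy : y ∈ Icc 0 h
    · rw [hin y hy, indicator_of_mem hy]
    · rw [hout y hy, indicator_of_notMem hy, measure_empty]
  simp_rw [hslice]
  rw [lintegral_indicator measurableSet_Icc, ← ofReal_integral_eq_lintegral_ofReal,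
    integral_Icc_eq_integral_Ioc, ← intervalIntegral.integral_of_le hh]
  · congr 1
    have hderiv : ∀ y ∈ uIcc 0 h, HasDerivAt (fun y => m * y + k * (h * y - y ^ 2 / 2))
        (m + k * (h - y)) y := by
      intro y _
      refine (((hasDerivAt_id' y).const_mul m).add ((((hasDerivAt_id' y).const_mul h).sub
        ((hasDerivAt_pow 2 y).div_const 2)).const_mul k)).congr_deriv ?_
      norm_num
    rw [intervalIntegral.integral_eq_sub_of_hasDerivAt hderiv
      (Continuous.intervalIntegrable (by fun_prop) _ _)]
    ring
  · exact (Continuous.integrableOn_Icc (by fun_prop))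
  · refine (ae_restrict_iff' measurableSet_Icc).mpr (Filter.Eventually.of_forall fun y hy => ?_)
    have := mul_nonneg hk (sub_nonneg.mpr hy.2)
    simp only [Pi.zero_apply]
    linarith

theorem measurableSet_modelTriangle (s : ℝ) : MeasurableSet (modelTriangle s) := by
  unfold modelTriangle
  exact (measurableSet_le measurable_const (measurable_pi_apply 0)).inter
    ((measurableSet_le measurable_const (measurable_pi_apply 1)).inter
      (measurableSet_lt ((measurable_pi_apply 0).add (measurable_pi_apply 1)) measurable_const))

theorem volume_modelTriangle {s : ℝ} (hs : 0 ≤ s) :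
    volume (modelTriangle s) = ENNReal.ofReal (s ^ 2 / 2) := by
  rw [volume_eq_of_slices (measurableSet_modelTriangle s) hs le_rfl zero_le_one]
  · simp
  · intro y hy
    have : {x : ℝ | ![x, y] ∈ modelTriangle s} = Ico 0 (s - y) := by
      ext x
      simp only [modelTriangle, mem_ofPred_eq, cons_val_zero, cons_val_one, mem_Ico]
      exact ⟨fun h => ⟨h.1, by linarith⟩, fun h => ⟨h.1, hy.1, by linarith⟩⟩
    rw [this, Real.volume_Ico]
    simp
  · intro y hy
    ext x
    simp only [modelTriangle, mem_ofPred_eq, cons_val_zero, cons_val_one, mem_empty_iff_false,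
      iff_false]
    rintro ⟨h1, h2, h3⟩
    exact hy ⟨h2, by linarith⟩

theorem measurableSet_cornerTriangle (D : Matrix.SpecialLinearGroup (Fin 2) ℤ) (p : Pt) (s : ℝ) :
    MeasurableSet (cornerTriangle D p s) := by
  have : cornerTriangle D p s = (fun z => sl2Apply D⁻¹ (z - p)) ⁻¹' modelTriangle s :=
    ext fun _ => mem_cornerTriangle
  rw [this]
  exact (((continuous_sl2Apply D⁻¹).comp (by fun_prop : Continuous fun z : Pt => z - p)).measurable)
    (measurableSet_modelTriangle s)

theorem volume_cornerTriangle (D : Matrix.SpecialLinearGroup (Fin 2) ℤ) (p : Pt) {s : ℝ}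
    (hs : 0 ≤ s) : volume (cornerTriangle D p s) = ENNReal.ofReal (s ^ 2 / 2) := by
  have e : cornerTriangle D p s = (fun x => x + p) ''
      (Matrix.toLin' ((D : Matrix (Fin 2) (Fin 2) ℤ).map (Int.cast : ℤ → ℝ)) ''
        modelTriangle s) := by
    rw [image_image]
    rfl
  have hdet : ((D : Matrix (Fin 2) (Fin 2) ℤ).map (Int.cast : ℤ → ℝ)).det = 1 := by
    have := D.det_coe
    rw [Matrix.det_fin_two] at this ⊢
    simp only [Matrix.map_apply]
    exact_mod_cast this
  rw [e, image_add_right, measure_preimage_add_right, Measure.addHaar_image_linearMap,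
    LinearMap.det_toLin', hdet, volume_modelTriangle hs]
  simp

theorem cornerTriangle_zero (D : Matrix.SpecialLinearGroup (Fin 2) ℤ) (p : Pt) :
    cornerTriangle D p 0 = ∅ := by
  ext z
  simp only [mem_cornerTriangle, modelTriangle, mem_ofPred_eq, mem_empty_iff_false, iff_false]
  rintro ⟨h1, h2, h3⟩
  linarith

/-- Packings are exactly the disjoint families of corner triangles contained in the polygon. -/
theorem isPacking_iff {k : ℕ} {V : Fin k → Pt} {D : Fin k → Matrix.SpecialLinearGroup (Fin 2) ℤ}
    (hD : ∀ i, IsCornerFrame (convexHull ℝ (range V)) (V i) (D i)) {s : Fin k → ℝ} {P : Set Pt} :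
    IsPacking V s P ↔ P = (⋃ i, cornerTriangle (D i) (V i) (s i)) ∧ (∀ i, 0 ≤ s i) ∧
      (∀ i, cornerTriangle (D i) (V i) (s i) ⊆ convexHull ℝ (range V)) ∧
      Pairwise (Function.onFun Disjoint fun i => cornerTriangle (D i) (V i) (s i)) := by
  constructor
  · rintro ⟨tri, hP, htri, hdisj⟩
    have key : tri = fun i => cornerTriangle (D i) (V i) (s i) := by
      funext i
      rcases htri i with ⟨h0, he⟩ | h
      · rw [he, h0, cornerTriangle_zero]
      · exact h.eq_cornerTriangle (hD i)
    subst key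
    refine ⟨hP, fun i => ?_, fun i => ?_, hdisj⟩
    · rcases htri i with h | h
      exacts [h.1.ge, h.1.le]
    · rcases htri i with h | h
      · simp only [h.2, empty_subset]
      · exact h.2.1
  · rintro ⟨hP, hs, hsub, hdisj⟩
    refine ⟨_, hP, fun i => ?_, hdisj⟩
    rcases (hs i).eq_or_lt with h | h
    · exact Or.inl ⟨h.symm, by rw [← h, cornerTriangle_zero]⟩
    · exact Or.inr ((hD i).isPackedTriangle h (hsub i))

theorem area_iUnion_cornerTriangle {k : ℕ} {V : Fin k → Pt}
    {D : Fin k → Matrix.SpecialLinearGroup (Fin 2) ℤ} {s : Fin k → ℝ} (hs : ∀ i, 0 ≤ s i)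
    (hdisj : Pairwise (Function.onFun Disjoint fun i => cornerTriangle (D i) (V i) (s i))) :
    area (⋃ i, cornerTriangle (D i) (V i) (s i)) = ∑ i, s i ^ 2 / 2 := by
  rw [area, measure_iUnion hdisj fun i => measurableSet_cornerTriangle _ _ _, tsum_fintype,
    ENNReal.toReal_sum]
  · refine Finset.sum_congr rfl fun i _ => ?_
    rw [volume_cornerTriangle _ _ (hs i), ENNReal.toReal_ofReal (by positivity)]
  · intro i _
    rw [volume_cornerTriangle _ _ (hs i)]
    exact ENNReal.ofReal_ne_top

/-- Two disjoint subsets of `Δ` growing from the two ends of an edge of length `L` cannot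
overlap along that edge. -/
theorem add_le_of_disjoint_along_edge {A B Δ : Set Pt} (f : ℝ → Pt) {L s t : ℝ} (hL : 0 < L)
    (hs : 0 ≤ s) (ht : 0 ≤ t) (hA : A ⊆ Δ) (hB : B ⊆ Δ) (hAB : Disjoint A B)
    (hfA : ∀ u, 0 ≤ u → u < s → f u ∈ A) (hfB : ∀ u, 0 ≤ u → u < t → f (L - u) ∈ B)
    (hf : ∀ u, f u ∈ Δ → 0 ≤ u ∧ u ≤ L) : s + t ≤ L := by
  by_contra! h
  have hpos : 0 < s + t := hL.trans h
  rcases hs.eq_or_lt with rfl | hs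
  · have := (hf _ (hB (hfB ((L + t) / 2) (by linarith) (by linarith)))).1
    linarith
  rcases ht.eq_or_lt with rfl | ht
  · have := (hf _ (hA (hfA ((L + s) / 2) (by linarith) (by linarith)))).2
    linarith
  have h1 : f (L * s / (s + t)) ∈ A :=
    hfA _ (by positivity) (by rw [div_lt_iff₀ hpos]; nlinarith)
  have h2 : f (L - L * t / (s + t)) ∈ B :=
    hfB _ (by positivity) (by rw [div_lt_iff₀ hpos]; nlinarith)
  have e : L - L * t / (s + t) = L * s / (s + t) := by field_simp; ring
  exact disjoint_left.mp hAB h1 (e ▸ h2)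

/-- The vertices of the Hirzebruch trapezoid. -/
def hirzebruchVertex (a b : ℝ) (n : ℤ) : Fin 4 → Pt :=
  ![![0, 0], ![0, a], ![b, a], ![b + (n : ℝ) * a, 0]]

/-- The Hirzebruch trapezoid as an intersection of half-planes. -/
def hirzebruchTrapezoid (a b : ℝ) (n : ℤ) : Set Pt :=
  {z | 0 ≤ z 0 ∧ 0 ≤ z 1 ∧ z 1 ≤ a ∧ z 0 + n * z 1 ≤ b + n * a}

/-- The unimodular frames of edge directions at the vertices of the Hirzebruch trapezoid. -/
def hirzebruchFrame (n : ℤ) : Fin 4 → Matrix.SpecialLinearGroup (Fin 2) ℤ :=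
  ![1, ⟨!![0, 1; -1, 0], by simp⟩, ⟨!![-1, n; 0, -1], by simp⟩, ⟨!![-n, -1; 1, 0], by simp⟩]

theorem convexHull_hirzebruchVertex {a b : ℝ} {n : ℤ} (ha : 0 < a) (hb : 0 < b) (hn : 0 < n) :
    convexHull ℝ (range (hirzebruchVertex a b n)) = hirzebruchTrapezoid a b n := by
  have hn' : (0 : ℝ) < n := by exact_mod_cast hn
  apply Subset.antisymm
  · apply convexHull_min
    · rintro _ ⟨i, rfl⟩
      have := mul_pos hn' ha
      fin_cases i <;>
        simp [hirzebruchVertex, hirzebruchTrapezoid] <;> (try constructor) <;> linarith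
    · intro x hx y hy u v hu hv huv
      obtain ⟨hx1, hx2, hx3, hx4⟩ := hx
      obtain ⟨hy1, hy2, hy3, hy4⟩ := hy
      obtain rfl : v = 1 - u := by linarith
      simp only [hirzebruchTrapezoid, mem_ofPred_eq, Pi.add_apply, Pi.smul_apply, smul_eq_mul]
      refine ⟨by positivity, by positivity, ?_, ?_⟩
      · nlinarith [mul_le_mul_of_nonneg_left hx3 hu, mul_le_mul_of_nonneg_left hy3 hv]
      · nlinarith [mul_le_mul_of_nonneg_left hx4 hu, mul_le_mul_of_nonneg_left hy4 hv]
  · rintro z ⟨h1, h2, h3, h4⟩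
    have hW : 0 < b + n * (a - z 1) := by
      have := mul_nonneg hn'.le (sub_nonneg.mpr h3)
      linarith
    set c := z 1 / a with hc
    set d := z 0 / (b + n * (a - z 1)) with hd
    have hcz : z 1 = c * a := by rw [hc]; field_simp
    have hdz : z 0 = d * (b + n * (a - z 1)) := by rw [hd]; field_simp
    have hc0 : 0 ≤ c := by positivity
    have hc1 : c ≤ 1 := (div_le_one ha).mpr h3
    have hd0 : 0 ≤ d := by positivity
    have hd1 : d ≤ 1 := (div_le_one hW).mpr (by linarith)
    have hconv := convex_convexHull ℝ (range (hirzebruchVertex a b n))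
    have hV : ∀ i, hirzebruchVertex a b n i ∈ convexHull ℝ (range (hirzebruchVertex a b n)) :=
      fun i => subset_convexHull ℝ _ (mem_range_self i)
    have hbot := hconv (hV 0) (hV 3) (sub_nonneg.mpr hd1) hd0 (by ring)
    have htop := hconv (hV 1) (hV 2) (sub_nonneg.mpr hd1) hd0 (by ring)
    convert hconv hbot htop (sub_nonneg.mpr hc1) hc0 (by ring) using 1
    ext i
    fin_cases i
    · simp [hirzebruchVertex, hdz, hcz]
      ring
    · simp [hirzebruchVertex, hcz]
      ring_nf
      simp

theorem mem_cornerTriangle_hirzebruch_zero {a b s : ℝ} {n : ℤ} {z : Pt} :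
    z ∈ cornerTriangle (hirzebruchFrame n 0) (hirzebruchVertex a b n 0) s ↔
      0 ≤ z 0 ∧ 0 ≤ z 1 ∧ z 0 + z 1 < s := by
  rw [mem_cornerTriangle_iff]
  simp [hirzebruchFrame, hirzebruchVertex]

theorem mem_cornerTriangle_hirzebruch_one {a b s : ℝ} {n : ℤ} {z : Pt} :
    z ∈ cornerTriangle (hirzebruchFrame n 1) (hirzebruchVertex a b n 1) s ↔
      z 1 ≤ a ∧ 0 ≤ z 0 ∧ a - z 1 + z 0 < s := by
  rw [mem_cornerTriangle_iff]
  simp [hirzebruchFrame, hirzebruchVertex]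

theorem mem_cornerTriangle_hirzebruch_two {a b s : ℝ} {n : ℤ} {z : Pt} :
    z ∈ cornerTriangle (hirzebruchFrame n 2) (hirzebruchVertex a b n 2) s ↔
      z 0 + n * z 1 ≤ b + n * a ∧ z 1 ≤ a ∧
        b + n * a - (z 0 + n * z 1) + (a - z 1) < s := by
  rw [mem_cornerTriangle_iff]
  have e : b - z 0 - n * (z 1 - a) = b + n * a - (z 0 + n * z 1) := by ring
  simp [hirzebruchFrame, hirzebruchVertex, e]

theorem mem_cornerTriangle_hirzebruch_three {a b s : ℝ} {n : ℤ} {z : Pt} :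
    z ∈ cornerTriangle (hirzebruchFrame n 3) (hirzebruchVertex a b n 3) s ↔
      0 ≤ z 1 ∧ z 0 + n * z 1 ≤ b + n * a ∧ z 1 + (b + n * a - (z 0 + n * z 1)) < s := by
  rw [mem_cornerTriangle_iff]
  have e : -(n * z 1) - (z 0 - (b + n * a)) = b + n * a - (z 0 + n * z 1) := by ring
  simp [hirzebruchFrame, hirzebruchVertex, e]

theorem cornerTriangle_hirzebruch_zero_subset {a b s : ℝ} {n : ℤ} (hb : 0 ≤ b) (hn : 0 < n)
    (hs : s ≤ a) : cornerTriangle (hirzebruchFrame n 0) (hirzebruchVertex a b n 0) s ⊆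
      hirzebruchTrapezoid a b n := by
  have hn' : (1 : ℝ) ≤ n := by exact_mod_cast hn
  intro z hz
  obtain ⟨h1, h2, h3⟩ := mem_cornerTriangle_hirzebruch_zero.mp hz
  exact ⟨h1, h2, by linarith, by nlinarith⟩

theorem cornerTriangle_hirzebruch_one_subset {a b s : ℝ} {n : ℤ} (hn : 0 < n)
    (hsa : s ≤ a) (hsb : s ≤ b) :
    cornerTriangle (hirzebruchFrame n 1) (hirzebruchVertex a b n 1) s ⊆
      hirzebruchTrapezoid a b n := by
  have hn' : (1 : ℝ) ≤ n := by exact_mod_cast hn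
  intro z hz
  obtain ⟨h1, h2, h3⟩ := mem_cornerTriangle_hirzebruch_one.mp hz
  exact ⟨h2, by linarith, h1, by nlinarith⟩

theorem cornerTriangle_hirzebruch_two_subset {a b s : ℝ} {n : ℤ} (hn : 0 < n)
    (hsa : s ≤ a) (hsb : s ≤ b) :
    cornerTriangle (hirzebruchFrame n 2) (hirzebruchVertex a b n 2) s ⊆
      hirzebruchTrapezoid a b n := by
  have hn' : (1 : ℝ) ≤ n := by exact_mod_cast hn
  intro z hz
  obtain ⟨h1, h2, h3⟩ := mem_cornerTriangle_hirzebruch_two.mp hz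
  exact ⟨by nlinarith, by linarith, h2, h1⟩

theorem cornerTriangle_hirzebruch_three_subset {a b s : ℝ} {n : ℤ} (hb : 0 ≤ b) (hn : 0 < n)
    (hs : s ≤ a) : cornerTriangle (hirzebruchFrame n 3) (hirzebruchVertex a b n 3) s ⊆
      hirzebruchTrapezoid a b n := by
  have hn' : (1 : ℝ) ≤ n := by exact_mod_cast hn
  intro z hz
  obtain ⟨h1, h2, h3⟩ := mem_cornerTriangle_hirzebruch_three.mp hz
  have h4 : z 1 ≤ a := by linarith
  exact ⟨by nlinarith [mul_nonneg (sub_nonneg.mpr hn') (sub_nonneg.mpr h4)], h1, h4, h2⟩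

theorem isCornerFrame_hirzebruch {a b : ℝ} {n : ℤ} (ha : 0 < a) (hb : 0 < b) (hn : 0 < n)
    (i : Fin 4) : IsCornerFrame (hirzebruchTrapezoid a b n) (hirzebruchVertex a b n i)
      (hirzebruchFrame n i) := by
  match i with
  | 0 =>
    exact ⟨fun z ⟨h1, h2, _, _⟩ =>
      ⟨_, mem_cornerTriangle_hirzebruch_zero.mpr ⟨h1, h2, lt_add_one _⟩⟩,
      a, ha, cornerTriangle_hirzebruch_zero_subset hb.le hn le_rfl⟩
  | 1 =>
    exact ⟨fun z ⟨h1, _, h3, _⟩ =>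
      ⟨_, mem_cornerTriangle_hirzebruch_one.mpr ⟨h3, h1, lt_add_one _⟩⟩,
      min a b, lt_min ha hb,
      cornerTriangle_hirzebruch_one_subset hn (min_le_left _ _) (min_le_right _ _)⟩
  | 2 =>
    exact ⟨fun z ⟨_, _, h3, h4⟩ =>
      ⟨_, mem_cornerTriangle_hirzebruch_two.mpr ⟨h4, h3, lt_add_one _⟩⟩,
      min a b, lt_min ha hb,
      cornerTriangle_hirzebruch_two_subset hn (min_le_left _ _) (min_le_right _ _)⟩
  | 3 =>
    exact ⟨fun z ⟨_, h2, _, h4⟩ =>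
      ⟨_, mem_cornerTriangle_hirzebruch_three.mpr ⟨h2, h4, lt_add_one _⟩⟩,
      a, ha, cornerTriangle_hirzebruch_three_subset hb.le hn le_rfl⟩

theorem area_hirzebruchTrapezoid {a b : ℝ} {n : ℤ} (ha : 0 < a) (hb : 0 < b) (hn : 0 < n) :
    area (hirzebruchTrapezoid a b n) = a * (n * a + 2 * b) / 2 := by
  have hn' : (0 : ℝ) < n := by exact_mod_cast hn
  have hmeas : MeasurableSet (hirzebruchTrapezoid a b n) := by
    have h0 : Measurable fun z : Pt => z 0 := measurable_pi_apply 0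
    have h1 : Measurable fun z : Pt => z 1 := measurable_pi_apply 1
    exact (measurableSet_le measurable_const h0).inter ((measurableSet_le measurable_const h1).inter
      ((measurableSet_le h1 measurable_const).inter
        (measurableSet_le (h0.add (h1.const_mul (n : ℝ))) measurable_const)))
  rw [area, volume_eq_of_slices hmeas ha.le hb.le hn'.le, ENNReal.toReal_ofReal (by positivity)]
  · ring
  · intro y hy
    have : {x : ℝ | ![x, y] ∈ hirzebruchTrapezoid a b n} = Icc 0 (b + n * (a - y)) := by
      ext x
      simp only [hirzebruchTrapezoid, mem_ofPred_eq, cons_val_zero, cons_val_one, mem_Icc]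
      exact ⟨fun h => ⟨h.1, by linarith [h.2.2.2]⟩, fun h => ⟨h.1, hy.1, hy.2, by linarith [h.2]⟩⟩
    rw [this, Real.volume_Icc, sub_zero]
  · intro y hy
    ext x
    simp only [hirzebruchTrapezoid, mem_ofPred_eq, cons_val_zero, cons_val_one,
      mem_empty_iff_false, iff_false]
    rintro ⟨-, h2, h3, -⟩
    exact hy ⟨h2, h3⟩

/-- The sizes of the triangles packed at the two ends of an edge of the Hirzebruch trapezoid
add up to at most the length of that edge. -/
theorem hirzebruch_size_constraints {a b : ℝ} {n : ℤ} (ha : 0 < a) (hb : 0 < b) (hn : 0 < n)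
    {s : Fin 4 → ℝ} (hs : ∀ i, 0 ≤ s i)
    (hsub : ∀ i, cornerTriangle (hirzebruchFrame n i) (hirzebruchVertex a b n i) (s i) ⊆
      hirzebruchTrapezoid a b n)
    (hdisj : Pairwise (Function.onFun Disjoint fun i =>
      cornerTriangle (hirzebruchFrame n i) (hirzebruchVertex a b n i) (s i))) :
    s 0 + s 1 ≤ a ∧ s 1 + s 2 ≤ b ∧ s 2 + s 3 ≤ a ∧ s 3 + s 0 ≤ b + n * a := by
  have hn' : (0 : ℝ) < n := by exact_mod_cast hn
  have hna := mul_pos hn' ha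
  refine ⟨?_, ?_, ?_, ?_⟩
  · refine add_le_of_disjoint_along_edge (fun u => ![0, u]) ha (hs 0) (hs 1) (hsub 0) (hsub 1)
      (hdisj (by decide)) (fun u h1 h2 => mem_cornerTriangle_hirzebruch_zero.mpr ?_)
      (fun u h1 h2 => mem_cornerTriangle_hirzebruch_one.mpr ?_) ?_
    · simp [h1, h2]
    · simp [h1, h2]
    · rintro u ⟨-, h2, h3, -⟩
      exact ⟨h2, h3⟩
  · refine add_le_of_disjoint_along_edge (fun u => ![u, a]) hb (hs 1) (hs 2) (hsub 1) (hsub 2)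
      (hdisj (by decide)) (fun u h1 h2 => mem_cornerTriangle_hirzebruch_one.mpr ?_)
      (fun u h1 h2 => mem_cornerTriangle_hirzebruch_two.mpr ?_) ?_
    · simp [h1, h2]
    · simp [h1, h2]
    · rintro u ⟨h1, -, -, h4⟩
      simp only [cons_val_zero, cons_val_one] at h1 h4
      exact ⟨h1, by linarith⟩
  · refine add_le_of_disjoint_along_edge (fun u => ![b + n * u, a - u]) ha (hs 2) (hs 3) (hsub 2)
      (hsub 3) (hdisj (by decide)) (fun u h1 h2 => mem_cornerTriangle_hirzebruch_two.mpr ?_)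
      (fun u h1 h2 => mem_cornerTriangle_hirzebruch_three.mpr ?_) ?_
    · simp only [cons_val_zero, cons_val_one]
      exact ⟨by linarith, by linarith, by linarith⟩
    · simp only [cons_val_zero, cons_val_one]
      exact ⟨by linarith, by linarith, by linarith⟩
    · rintro u ⟨-, h2, h3, -⟩
      simp only [cons_val_one, cons_val_fin_one] at h2 h3
      exact ⟨by linarith, by linarith⟩
  · refine add_le_of_disjoint_along_edge (fun u => ![b + n * a - u, 0]) (by positivity) (hs 3)
      (hs 0) (hsub 3) (hsub 0) (hdisj (by decide))
      (fun u h1 h2 => mem_cornerTriangle_hirzebruch_three.mpr ?_)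
      (fun u h1 h2 => mem_cornerTriangle_hirzebruch_zero.mpr ?_) ?_
    · simp [h1, h2]
    · simp [h1, h2]
    · rintro u ⟨h1, -, -, h4⟩
      simp only [cons_val_zero, cons_val_one] at h1 h4
      exact ⟨by linarith, by linarith⟩

theorem pairwise_disjoint_hirzebruch {a b p r t : ℝ} {n : ℤ} (hn : 0 < n)
    (hp : p ≤ a) (hr : r ≤ b) (ht : t ≤ a) (hb : 0 < b) (hrt : r + t ≤ a)
    (htp : t + p ≤ b + n * a) :
    Pairwise (Function.onFun Disjoint fun i =>
      cornerTriangle (hirzebruchFrame n i) (hirzebruchVertex a b n i)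
        ((![p, 0, r, t] : Fin 4 → ℝ) i)) := by
  have hn' : (1 : ℝ) ≤ n := by exact_mod_cast hn
  set T : Fin 4 → Set Pt := fun i =>
    cornerTriangle (hirzebruchFrame n i) (hirzebruchVertex a b n i)
      ((![p, 0, r, t] : Fin 4 → ℝ) i)
  have hT1 : T 1 = ∅ := cornerTriangle_zero _ _
  have h02 : Disjoint (T 0) (T 2) := by
    refine disjoint_left.mpr fun z hz hz' => ?_
    obtain ⟨h1, h2, h3⟩ := mem_cornerTriangle_hirzebruch_zero.mp hz
    obtain ⟨k1, k2, k3⟩ := mem_cornerTriangle_hirzebruch_two.mp hz'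
    simp only [cons_val] at h3 k3
    nlinarith [mul_nonneg (sub_nonneg.mpr hn') (sub_nonneg.mpr k2)]
  have h03 : Disjoint (T 0) (T 3) := by
    refine disjoint_left.mpr fun z hz hz' => ?_
    obtain ⟨h1, h2, h3⟩ := mem_cornerTriangle_hirzebruch_zero.mp hz
    obtain ⟨k1, k2, k3⟩ := mem_cornerTriangle_hirzebruch_three.mp hz'
    simp only [cons_val] at h3 k3
    obtain rfl | hn2 : n = 1 ∨ 2 ≤ n := by lia
    · norm_num at *
      linarith
    · have hn2' : (2 : ℝ) ≤ n := by exact_mod_cast hn2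
      have hza : z 1 ≤ a := by linarith
      nlinarith [mul_nonneg (sub_nonneg.mpr hn2') (sub_nonneg.mpr hza)]
  have h23 : Disjoint (T 2) (T 3) := by
    refine disjoint_left.mpr fun z hz hz' => ?_
    obtain ⟨h1, h2, h3⟩ := mem_cornerTriangle_hirzebruch_two.mp hz
    obtain ⟨k1, k2, k3⟩ := mem_cornerTriangle_hirzebruch_three.mp hz'
    simp only [cons_val] at h3 k3
    linarith
  have h1 : ∀ S : Set Pt, Disjoint S (T 1) := fun S => hT1 ▸ disjoint_empty S
  rw [pairwise_disjoint_on]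
  intro i j hij
  fin_cases i <;> fin_cases j <;> first | exact absurd hij (by decide) | skip
  exacts [h1 _, h02, h03, (h1 _).symm, (h1 _).symm, h23]

/-- If the constraints along the edges bound the sum of the squared sizes by `M`, and `M` is
attained by admissible sizes `p, 0, r, t`, then `M` determines the toric packing density. -/
theorem isLUB_densitySet_hirzebruch {a b M p r t ρ : ℝ} {n : ℤ} (ha : 0 < a) (hb : 0 < b)
    (hn : 0 < n) (hbound : ∀ w x y z : ℝ, 0 ≤ w → 0 ≤ x → 0 ≤ y → 0 ≤ z → w + x ≤ a → x + y ≤ b →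
      y + z ≤ a → z + w ≤ b + n * a → w ^ 2 + x ^ 2 + y ^ 2 + z ^ 2 ≤ M)
    (hp0 : 0 ≤ p) (hr0 : 0 ≤ r) (ht0 : 0 ≤ t) (hp : p ≤ a) (hr : r ≤ b) (hrt : r + t ≤ a)
    (htp : t + p ≤ b + n * a) (hM : p ^ 2 + r ^ 2 + t ^ 2 = M)
    (hρ : ρ = M / (a * (n * a + 2 * b))) :
    IsLUB (densitySet (hirzebruchVertex a b n)) ρ := by
  subst hρ
  have hn' : (0 : ℝ) < n := by exact_mod_cast hn
  have hframe : ∀ i, IsCornerFrame (convexHull ℝ (range (hirzebruchVertex a b n)))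
      (hirzebruchVertex a b n i) (hirzebruchFrame n i) := by
    rw [convexHull_hirzebruchVertex ha hb hn]
    exact isCornerFrame_hirzebruch ha hb hn
  have hdens : ∀ S : ℝ, S / 2 / (a * (n * a + 2 * b) / 2) = S / (a * (n * a + 2 * b)) :=
    fun S => div_div_div_cancel_right₀ two_ne_zero _ _
  apply IsGreatest.isLUB
  constructor
  · have hdisj := pairwise_disjoint_hirzebruch (a := a) (b := b) (n := n) hn hp hr
      (by linarith) hb hrt htp
    have hs : ∀ i, 0 ≤ (![p, 0, r, t] : Fin 4 → ℝ) i := by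
      intro i
      fin_cases i
      exacts [hp0, le_rfl, hr0, ht0]
    refine ⟨![p, 0, r, t], _, (isPacking_iff hframe).mpr ⟨rfl, hs, ?_, hdisj⟩, ?_⟩
    · rw [convexHull_hirzebruchVertex ha hb hn]
      intro i
      match i with
      | 0 => exact cornerTriangle_hirzebruch_zero_subset hb.le hn hp
      | 1 => exact cornerTriangle_hirzebruch_one_subset hn ha.le hb.le
      | 2 => exact cornerTriangle_hirzebruch_two_subset hn (show r ≤ a by linarith) hr
      | 3 => exact cornerTriangle_hirzebruch_three_subset hb.le hn (show t ≤ a by linarith)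
    · rw [area_iUnion_cornerTriangle hs hdisj, convexHull_hirzebruchVertex ha hb hn,
        area_hirzebruchTrapezoid ha hb hn, ← Finset.sum_div, hdens, ← hM]
      simp [Fin.sum_univ_four]
  · rintro _ ⟨s, P, hP, rfl⟩
    obtain ⟨rfl, hs, hsub, hdisj⟩ := (isPacking_iff hframe).mp hP
    rw [area_iUnion_cornerTriangle hs hdisj, convexHull_hirzebruchVertex ha hb hn,
      area_hirzebruchTrapezoid ha hb hn, ← Finset.sum_div, hdens]
    rw [convexHull_hirzebruchVertex ha hb hn] at hsub
    obtain ⟨h01, h12, h23, h30⟩ := hirzebruch_size_constraints ha hb hn hs hsub hdisj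
    refine div_le_div_of_nonneg_right ?_ (by positivity)
    rw [Fin.sum_univ_four]
    exact hbound _ _ _ _ (hs 0) (hs 1) (hs 2) (hs 3) h01 h12 h23 h30

theorem sum_sq_le_two_mul_sq {a w x y z : ℝ} (hw : 0 ≤ w) (hx : 0 ≤ x) (hy : 0 ≤ y) (hz : 0 ≤ z)
    (hwx : w + x ≤ a) (hyz : y + z ≤ a) : w ^ 2 + x ^ 2 + y ^ 2 + z ^ 2 ≤ 2 * a ^ 2 := by
  nlinarith [mul_nonneg hw hx, mul_nonneg hy hz, pow_le_pow_left₀ (add_nonneg hw hx) hwx 2,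
    pow_le_pow_left₀ (add_nonneg hy hz) hyz 2]

theorem sq_add_sq_le {a c u v : ℝ} (hu : 0 ≤ u) (hv : 0 ≤ v) (huc : u ≤ c) (hvc : v ≤ c)
    (huv : u + v ≤ a) : u ^ 2 + v ^ 2 ≤ c ^ 2 + (a - c) ^ 2 := by
  rcases le_total u (a - c) with h | h
  · nlinarith
  · nlinarith [mul_nonneg (sub_nonneg.mpr huc) (sub_nonneg.mpr h),
      pow_le_pow_left₀ hv (show v ≤ a - u by linarith) 2]

theorem sum_sq_le_of_le_left {a b w x y z : ℝ} (hx : 0 ≤ x) (hy : 0 ≤ y) (hz : 0 ≤ z)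
    (hwb : b ≤ w) (hwx : w + x ≤ a) (hxy : x + y ≤ b) (hyz : y + z ≤ a) (hzw : z + w ≤ b + a) :
    w ^ 2 + x ^ 2 + y ^ 2 + z ^ 2 ≤ a ^ 2 + b ^ 2 + (a - b) ^ 2 := by
  have h1 := sq_add_sq_le (c := a + b - w) hy hz (by linarith) (by linarith) hyz
  have h2 := pow_le_pow_left₀ hx (show x ≤ a - w by linarith) 2
  nlinarith [mul_nonneg (sub_nonneg.mpr hwb) (show 0 ≤ a - w by linarith)]

theorem sum_sq_le_of_le {a b w x y z : ℝ} (hw : 0 ≤ w) (hx : 0 ≤ x) (hy : 0 ≤ y) (hz : 0 ≤ z)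
    (hb : 0 ≤ b) (hba : b ≤ a) (hwx : w + x ≤ a) (hxy : x + y ≤ b) (hyz : y + z ≤ a)
    (hzw : z + w ≤ b + a) :
    w ^ 2 + x ^ 2 + y ^ 2 + z ^ 2 ≤ a ^ 2 + b ^ 2 + (a - b) ^ 2 := by
  rcases le_total b w with h | h
  · exact sum_sq_le_of_le_left hx hy hz h hwx hxy hyz hzw
  rcases le_total b z with h' | h'
  · have := sum_sq_le_of_le_left (a := a) (b := b) hy hx hw h' (by linarith) (by linarith)
      (by linarith) (by linarith)
    linarith
  · have h1 := sq_add_sq_le hw hx h (by linarith) hwx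
    have h2 := sq_add_sq_le hy hz (by linarith) h' hyz
    nlinarith

theorem sum_sq_le_sq_add_two_mul_sq {a b w x y z : ℝ} (hw : 0 ≤ w) (hx : 0 ≤ x) (hy : 0 ≤ y)
    (hz : 0 ≤ z) (hb : 0 ≤ b) (hba : b ≤ a) (hwx : w + x ≤ a) (hxy : x + y ≤ b) (hyz : y + z ≤ a)
    (hzw : z + w ≤ b + a) :
    w ^ 2 + x ^ 2 + y ^ 2 + z ^ 2 ≤ a ^ 2 + 2 * b ^ 2 := by
  have hxy2 := pow_le_pow_left₀ (add_nonneg hx hy) hxy 2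
  rcases le_total (w + z) (a - b) with h | h
  · have := pow_le_pow_left₀ (add_nonneg hw hz) h 2
    nlinarith [mul_nonneg hw hz, mul_nonneg hx hy]
  · have h1 : (w + z - a) ^ 2 ≤ b ^ 2 := sq_le_sq' (by linarith) (by linarith)
    have h2 : 0 ≤ (a - w) * (a - z) := mul_nonneg (by linarith) (by linarith)
    nlinarith [mul_nonneg hx hy]

/-- The toric packing density of the Hirzebruch trapezoid with vertices
`(0,0)`, `(0,a)`, `(b,a)`, `(b+na,0)`, for `a, b > 0` and `n` a positive integer. -/
theorem stmt8 (a b : ℝ) (n : ℤ) (ha : 0 < a) (hb : 0 < b) (hn : 0 < n) :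
    (1 < n → IsLUB
      (densitySet (![![0, 0], ![0, a], ![b, a], ![b + (n : ℝ) * a, 0]] : Fin 4 → Pt))
      (2 * a / ((n : ℝ) * a + 2 * b))) ∧
    (n = 1 → a ≤ b → IsLUB
      (densitySet (![![0, 0], ![0, a], ![b, a], ![b + (n : ℝ) * a, 0]] : Fin 4 → Pt))
      (2 * a / (a + 2 * b))) ∧
    (n = 1 → b < a → a < 2 * b → IsLUB
      (densitySet (![![0, 0], ![0, a], ![b, a], ![b + (n : ℝ) * a, 0]] : Fin 4 → Pt))
      ((a ^ 2 + b ^ 2 + (a - b) ^ 2) / ((a + 2 * b) * a))) ∧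
    (n = 1 → 2 * b ≤ a → IsLUB
      (densitySet (![![0, 0], ![0, a], ![b, a], ![b + (n : ℝ) * a, 0]] : Fin 4 → Pt))
      ((a ^ 2 + 2 * b ^ 2) / ((a + 2 * b) * a))) := by
  have hvtx : (![![0, 0], ![0, a], ![b, a], ![b + (n : ℝ) * a, 0]] : Fin 4 → Pt) =
    hirzebruchVertex a b n := rfl
  rw [hvtx]
  refine ⟨fun h => ?_, ?_, ?_, ?_⟩
  · have hn2 : (2 : ℝ) ≤ n := by exact_mod_cast h
    exact isLUB_densitySet_hirzebruch (M := 2 * a ^ 2) (p := a) (r := 0) (t := a) ha hb hn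
      (fun w x y z hw hx hy hz hwx _ hyz _ => sum_sq_le_two_mul_sq hw hx hy hz hwx hyz)
      ha.le le_rfl ha.le le_rfl hb.le (by linarith) (by nlinarith) (by ring) (by field_simp)
  · rintro rfl hab
    exact isLUB_densitySet_hirzebruch (M := 2 * a ^ 2) (p := a) (r := 0) (t := a) ha hb hn
      (fun w x y z hw hx hy hz hwx _ hyz _ => sum_sq_le_two_mul_sq hw hx hy hz hwx hyz)
      ha.le le_rfl ha.le le_rfl hb.le (by linarith) (by simpa using hab) (by ring)
      (by push_cast; field_simp)
  · rintro rfl hba hab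
    exact isLUB_densitySet_hirzebruch (p := a) (r := a - b) (t := b) ha hb hn
      (fun w x y z hw hx hy hz hwx hxy hyz hzw =>
        sum_sq_le_of_le hw hx hy hz hb.le hba.le hwx hxy hyz (by simpa using hzw))
      ha.le (by linarith) hb.le le_rfl (by linarith) (by linarith) (by simp) (by ring)
      (by push_cast; ring)
  · rintro rfl hab
    exact isLUB_densitySet_hirzebruch (p := a) (r := b) (t := b) ha hb hn
      (fun w x y z hw hx hy hz hwx hxy hyz hzw =>
        sum_sq_le_sq_add_two_mul_sq hw hx hy hz hb.le (by linarith) hwx hxy hyz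
          (by simpa using hzw))
      ha.le hb.le hb.le le_rfl le_rfl (by linarith) (by simp) (by ring) (by push_cast; ring)
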